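/- (Theorem 2) Let A be a countably infinite family of rectangles with widths wᵢ > 0 and heights lᵢ > 0 satisfying (C1) Σᵢ lᵢ² < ∞ and (C2) wᵢ ≤ lᵢ and lᵢ₊₁ ≤ lᵢ for all i, and let Aⁿ denote the finite family of the first n rectangles. Then the best packing efficiency η₀(A) is well-defined and η₀(Aⁿ) → η₀(A) as n → ∞. -/

import Mathlib

open Set Finset Function

/-- A positioning of a family of rectangles (widths `w`, heights `l`) assigns
lower-left corners `(a i, b i)` so that the open interiors are pairwise disjoint. -/
def IsPositioning {ι : Type*} (w l a b : ι → ℝ) : Prop :=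
  ∀ i j, i ≠ j →
    Disjoint (Set.Ioo (a i) (a i + w i) ×ˢ Set.Ioo (b i) (b i + l i))
             (Set.Ioo (a j) (a j + w j) ×ˢ Set.Ioo (b j) (b j + l j))

/-- Horizontal extent `p(M) = max_{i,j} ((a i + w i) - a j)`. -/
noncomputable def pval {n : ℕ} (w a : Fin n → ℝ) : ℝ :=
  ⨆ i, ⨆ j, (a i + w i - a j)

/-- Vertical extent `q(M) = max_{i,j} ((b i + l i) - b j)`. -/
noncomputable def qval {n : ℕ} (l b : Fin n → ℝ) : ℝ :=
  ⨆ i, ⨆ j, (b i + l i - b j)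

/-- Bounding area `T(M) = p(M) * q(M)`. -/
noncomputable def Tval {n : ℕ} (w l a b : Fin n → ℝ) : ℝ :=
  pval w a * qval l b

/-- Total area `S(A) = ∑ i, w i * l i`. -/
noncomputable def Sval {n : ℕ} (w l : Fin n → ℝ) : ℝ :=
  ∑ i, w i * l i

/-- Packing efficiency `η(M) = S(A) / T(M)`. -/
noncomputable def eta {n : ℕ} (w l a b : Fin n → ℝ) : ℝ :=
  Sval w l / Tval w l a b

/-- Best packing efficiency `η₀(A) = sup over positionings M of η(M)`. -/
noncomputable def eta0 {n : ℕ} (w l : Fin n → ℝ) : ℝ :=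
  sSup {e | ∃ a b : Fin n → ℝ, IsPositioning w l a b ∧ e = eta w l a b}

/-- Minimal bounding area `T₀(A) = inf over positionings M of T(M)`. -/
noncomputable def T0 {n : ℕ} (w l : Fin n → ℝ) : ℝ :=
  sInf {t | ∃ a b : Fin n → ℝ, IsPositioning w l a b ∧ t = Tval w l a b}

/-- Minimal bounding area of a countably infinite family of rectangles:
the infimum of `P * Q` over all positionings that fit within horizontal extent `P`
and vertical extent `Q`. -/
noncomputable def T0inf (w l : ℕ → ℝ) : ℝ :=
  sInf {t | ∃ a b : ℕ → ℝ, ∃ P Q : ℝ, IsPositioning w l a b ∧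
    (∀ i j, a i + w i - a j ≤ P) ∧ (∀ i j, b i + l i - b j ≤ Q) ∧ t = P * Q}

open Filter Topology

/-- State `(x, y, h)` of next-fit shelf packing in a strip of width `W`: the corner `(x, y)` of
the `i`-th square of side `l i` and the height `h` of the current shelf. -/
noncomputable def shelf (l : ℕ → ℝ) (W : ℝ) : ℕ → ℝ × ℝ × ℝ
  | 0 => (0, 0, l 0)
  | i + 1 =>
    if (shelf l W i).1 + l i + l (i + 1) ≤ W then
      ((shelf l W i).1 + l i, (shelf l W i).2.1, (shelf l W i).2.2)
    else (0, (shelf l W i).2.1 + (shelf l W i).2.2, l (i + 1))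

section Shelf

variable {l : ℕ → ℝ} {W : ℝ}

theorem shelf_invariant (hl : ∀ i, 0 < l i) (hanti : Antitone l) (hW : 2 * l 0 ≤ W) (i : ℕ) :
    0 ≤ (shelf l W i).1 ∧ 0 ≤ (shelf l W i).2.1 ∧ l i ≤ (shelf l W i).2.2 ∧
      (shelf l W i).1 + l i ≤ W ∧
      W / 2 * ((shelf l W i).2.1 + (shelf l W i).2.2 - l 0) + (shelf l W i).1 * l i ≤
        ∑ j ∈ Finset.range i, l j ^ 2 := by
  induction i with
  | zero =>
    have := hl 0
    simp only [shelf]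
    refine ⟨le_rfl, le_rfl, le_rfl, by linarith, by simp⟩
  | succ i ih =>
    obtain ⟨h1, h2, h3, h4, h5⟩ := ih
    have hi := hl i
    have hi' := hl (i + 1)
    have hle : l (i + 1) ≤ l i := hanti (Nat.le_succ i)
    have h0 : l (i + 1) ≤ l 0 := hanti (Nat.zero_le _)
    rw [Finset.sum_range_succ]
    simp only [shelf]
    split_ifs with h
    · refine ⟨by linarith, h2, by linarith, by linarith, ?_⟩
      simp only
      nlinarith [mul_le_mul_of_nonneg_left hle (by linarith : 0 ≤ (shelf l W i).1 + l i)]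
    · refine ⟨le_rfl, by simp only; linarith, le_rfl, by simp only; linarith, ?_⟩
      simp only
      push Not at h
      have e1 : l (i + 1) * (W / 2) ≤ l i * ((shelf l W i).1 + l i) :=
        mul_le_mul hle (by linarith) (by linarith) hi.le
      nlinarith

theorem shelf_separated (hl : ∀ i, 0 < l i) (hanti : Antitone l) (hW : 2 * l 0 ≤ W)
    {i j : ℕ} (hij : i < j) :
    (shelf l W i).1 + l i ≤ (shelf l W j).1 ∨ (shelf l W i).2.1 + l i ≤ (shelf l W j).2.1 := by
  have key : ((shelf l W j).2 = (shelf l W i).2 ∧ (shelf l W i).1 + l i ≤ (shelf l W j).1) ∨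
      (shelf l W i).2.1 + (shelf l W i).2.2 ≤ (shelf l W j).2.1 := by
    induction j, hij using Nat.le_induction with
    | base =>
      simp only [shelf]
      split_ifs with h
      · exact Or.inl ⟨rfl, le_rfl⟩
      · exact Or.inr le_rfl
    | succ j hj ih =>
      have hj' := hl j
      have hh := (shelf_invariant hl hanti hW j).2.2.1
      rw [shelf]
      split_ifs with h
      · rcases ih with ⟨e, hx⟩ | hy
        · exact Or.inl ⟨e, by simp only; linarith⟩
        · exact Or.inr hy
      · right
        rcases ih with ⟨e, hx⟩ | hy
        · rw [e]
        · simp only; linarith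
  have hh := (shelf_invariant hl hanti hW i).2.2.1
  rcases key with ⟨-, hx⟩ | hy
  · exact Or.inl hx
  · exact Or.inr (by linarith)

/-- Squares of decreasing sides and finite total area pack into a strip of width `W`, at least
twice the largest side, up to height `l 0 + 2 / W * ∑' i, l i ^ 2`. -/
theorem exists_shelf_packing (hl : ∀ i, 0 < l i) (hanti : Antitone l) (hW : 2 * l 0 ≤ W)
    (hs : Summable fun i => l i ^ 2) :
    ∃ x y : ℕ → ℝ, (∀ i, 0 ≤ x i) ∧ (∀ i, 0 ≤ y i) ∧ (∀ i, x i + l i ≤ W) ∧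
      (∀ i, y i + l i ≤ l 0 + 2 / W * ∑' j, l j ^ 2) ∧
      ∀ i j, i < j → x i + l i ≤ x j ∨ y i + l i ≤ y j := by
  refine ⟨fun i => (shelf l W i).1, fun i => (shelf l W i).2.1,
    fun i => (shelf_invariant hl hanti hW i).1, fun i => (shelf_invariant hl hanti hW i).2.1,
    fun i => (shelf_invariant hl hanti hW i).2.2.2.1, fun i => ?_,
    fun i j hij => shelf_separated hl hanti hW hij⟩
  obtain ⟨h1, h2, h3, h4, h5⟩ := shelf_invariant hl hanti hW i
  have hWpos : 0 < W := by linarith [hl 0]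
  have hsum := hs.sum_le_tsum (Finset.range i) (fun j _ => sq_nonneg (l j))
  have hx := mul_nonneg h1 (hl i).le
  have : (shelf l W i).2.1 + (shelf l W i).2.2 - l 0 ≤ 2 / W * ∑' j, l j ^ 2 := by
    rw [div_mul_eq_mul_div, le_div_iff₀ hWpos]
    linarith
  simp only
  linarith

end Shelf

theorem disjoint_Ioo_prod_of_le {a a' b b' w w' h h' : ℝ} (H : a + w ≤ a' ∨ b + h ≤ b') :
    Disjoint (Set.Ioo a (a + w) ×ˢ Set.Ioo b (b + h))
      (Set.Ioo a' (a' + w') ×ˢ Set.Ioo b' (b' + h')) := by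
  rw [Set.disjoint_left]
  rintro ⟨u, v⟩ ⟨⟨_, h2⟩, ⟨_, h4⟩⟩ ⟨⟨h5, _⟩, ⟨h7, _⟩⟩
  simp only at h2 h4 h5 h7
  rcases H with H | H <;> linarith

theorem isPositioning_of_lt {ι : Type*} [LinearOrder ι] {w l a b : ι → ℝ}
    (h : ∀ i j, i < j →
      Disjoint (Set.Ioo (a i) (a i + w i) ×ˢ Set.Ioo (b i) (b i + l i))
        (Set.Ioo (a j) (a j + w j) ×ˢ Set.Ioo (b j) (b j + l j))) :
    IsPositioning w l a b := by
  intro i j hij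
  rcases lt_or_gt_of_ne hij with hlt | hlt
  · exact h i j hlt
  · exact (h j i hlt).symm

theorem le_pval {n : ℕ} (w a : Fin n → ℝ) (i j : Fin n) : a i + w i - a j ≤ pval w a :=
  (le_ciSup (f := fun j => a i + w i - a j) (Set.finite_range _).bddAbove j).trans
    (le_ciSup (f := fun i => ⨆ j, (a i + w i - a j)) (Set.finite_range _).bddAbove i)

theorem pval_le {n : ℕ} [Nonempty (Fin n)] {w a : Fin n → ℝ} {P : ℝ}
    (h : ∀ i j, a i + w i - a j ≤ P) : pval w a ≤ P :=
  ciSup_le fun i => ciSup_le fun j => h i j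

theorem le_qval {n : ℕ} (l b : Fin n → ℝ) (i j : Fin n) : b i + l i - b j ≤ qval l b :=
  le_pval l b i j

theorem qval_le {n : ℕ} [Nonempty (Fin n)] {l b : Fin n → ℝ} {Q : ℝ}
    (h : ∀ i j, b i + l i - b j ≤ Q) : qval l b ≤ Q :=
  pval_le h

section Infinite

variable {w l : ℕ → ℝ}

/-- The areas of the bounding boxes over which `T0inf` takes the infimum. -/
def boxAreas (w l : ℕ → ℝ) : Set ℝ :=
  {t | ∃ a b : ℕ → ℝ, ∃ P Q : ℝ, IsPositioning w l a b ∧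
    (∀ i j, a i + w i - a j ≤ P) ∧ (∀ i j, b i + l i - b j ≤ Q) ∧ t = P * Q}

theorem le_of_mem_boxAreas (hw : ∀ i, 0 < w i) (hl : ∀ i, 0 < l i) {t : ℝ}
    (ht : t ∈ boxAreas w l) : w 0 * l 0 ≤ t := by
  obtain ⟨a, b, P, Q, -, hP, hQ, rfl⟩ := ht
  have h1 := hP 0 0
  have h2 := hQ 0 0
  exact mul_le_mul (by linarith) (by linarith) (hl 0).le (by linarith [hw 0])

theorem bddBelow_boxAreas (hw : ∀ i, 0 < w i) (hl : ∀ i, 0 < l i) : BddBelow (boxAreas w l) :=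
  ⟨w 0 * l 0, fun _ ht => le_of_mem_boxAreas hw hl ht⟩

theorem boxAreas_nonempty (hl : ∀ i, 0 < l i) (hanti : Antitone l)
    (hwl : ∀ i, w i ≤ l i) (hs : Summable fun i => l i ^ 2) : (boxAreas w l).Nonempty := by
  obtain ⟨x, y, hx, hy, hxW, hyH, hsep⟩ := exists_shelf_packing hl hanti le_rfl hs
  refine ⟨_, x, y, 2 * l 0, l 0 + 2 / (2 * l 0) * ∑' j, l j ^ 2,
    isPositioning_of_lt fun i j hij => disjoint_Ioo_prod_of_le ?_,
    fun i j => ?_, fun i j => ?_, rfl⟩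
  · exact (hsep i j hij).imp_left fun h => by linarith [hwl i]
  · linarith [hxW i, hx j, hwl i]
  · linarith [hyH i, hy j]

theorem T0inf_pos (hw : ∀ i, 0 < w i) (hl : ∀ i, 0 < l i) (hanti : Antitone l)
    (hwl : ∀ i, w i ≤ l i) (hs : Summable fun i => l i ^ 2) : 0 < T0inf w l :=
  (mul_pos (hw 0) (hl 0)).trans_le
    (le_csInf (boxAreas_nonempty hl hanti hwl hs) fun _ ht => le_of_mem_boxAreas hw hl ht)

/-- A bound on the height of a strip of width `w 0` holding the rectangles from the `n`-th on. -/
noncomputable def tailHeight (w l : ℕ → ℝ) (n : ℕ) : ℝ :=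
  l n + 2 / w 0 * ∑' k, l (k + n) ^ 2

theorem tendsto_zero_of_summable_sq (hs : Summable fun i => l i ^ 2) :
    Tendsto l atTop (𝓝 0) := by
  have h := hs.tendsto_atTop_zero.sqrt
  simp only [Real.sqrt_sq_eq_abs, Real.sqrt_zero] at h
  exact (tendsto_zero_iff_abs_tendsto_zero l).2 h

theorem tendsto_tailHeight (hs : Summable fun i => l i ^ 2) :
    Tendsto (tailHeight w l) atTop (𝓝 0) := by
  have h := (tendsto_zero_of_summable_sq hs).add
    ((tendsto_sum_nat_add fun i => l i ^ 2).const_mul (2 / w 0))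
  rw [mul_zero, add_zero] at h
  exact h

variable {n : ℕ} {a b : Fin n → ℝ}

/-- The rectangles from the `n`-th on fit on top of any positioning of the first `n`. -/
theorem mul_add_tailHeight_mem_boxAreas (hn : 0 < n)
    (hl : ∀ i, 0 < l i) (hanti : Antitone l) (hwl : ∀ i, w i ≤ l i)
    (hs : Summable fun i => l i ^ 2) (hln : 2 * l n ≤ w 0)
    (hM : IsPositioning (fun i : Fin n => w i) (fun i : Fin n => l i) a b) :
    pval (fun i : Fin n => w i) a * (qval (fun i : Fin n => l i) b + tailHeight w l n) ∈
      boxAreas w l := by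
  have : Nonempty (Fin n) := ⟨⟨0, hn⟩⟩
  obtain ⟨x, y, hx, hy, hxW, hyH, hsep⟩ :=
    exists_shelf_packing (l := fun k => l (k + n)) (W := w 0) (fun k => hl _)
      (fun i j hij => hanti (by omega)) (by simpa using hln) ((summable_nat_add_iff n).2 hs)
  simp only [zero_add] at hyH
  obtain ⟨j₀, hj₀⟩ := Finite.exists_min a
  obtain ⟨j₁, hj₁⟩ := Finite.exists_min b
  obtain ⟨i₁, hi₁⟩ := Finite.exists_max fun i : Fin n => b i + l i
  set p := pval (fun i : Fin n => w i) a
  set q := qval (fun i : Fin n => l i) b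
  have hpw : w 0 ≤ p := by
    have := le_pval (fun i : Fin n => w i) a ⟨0, hn⟩ ⟨0, hn⟩
    simp only at this
    linarith
  have hpa : ∀ i, a i + w i - a j₀ ≤ p := fun i => le_pval (fun i : Fin n => w i) a i j₀
  have hqb : b i₁ + l i₁ - b j₁ ≤ q := le_qval (fun i : Fin n => l i) b i₁ j₁
  have hH : 0 ≤ tailHeight w l n := by
    rw [tailHeight]
    linarith [hyH 0, hy 0, hl (0 + n)]
  let a' : ℕ → ℝ := fun i => if h : i < n then a ⟨i, h⟩ else a j₀ + x (i - n)
  let b' : ℕ → ℝ := fun i => if h : i < n then b ⟨i, h⟩ else b i₁ + l i₁ + y (i - n)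
  have ha' : ∀ i (h : i < n), a' i = a ⟨i, h⟩ := fun i h => dif_pos h
  have hb' : ∀ i (h : i < n), b' i = b ⟨i, h⟩ := fun i h => dif_pos h
  have ha'' : ∀ i, ¬ i < n → a' i = a j₀ + x (i - n) := fun i h => dif_neg h
  have hb'' : ∀ i, ¬ i < n → b' i = b i₁ + l i₁ + y (i - n) := fun i h => dif_neg h
  have hsub : ∀ i, ¬ i < n → l (i - n + n) = l i := fun i h => by
    rw [Nat.sub_add_cancel (not_lt.1 h)]
  refine ⟨a', b', p, q + tailHeight w l n, isPositioning_of_lt fun i j hij => ?_,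
    fun i j => ?_, fun i j => ?_, rfl⟩
  · by_cases hj : j < n
    · have hi : i < n := hij.trans hj
      rw [ha' i hi, ha' j hj, hb' i hi, hb' j hj]
      exact hM ⟨i, hi⟩ ⟨j, hj⟩ (by simpa using hij.ne)
    · apply disjoint_Ioo_prod_of_le
      by_cases hi : i < n
      · right
        rw [hb' i hi, hb'' j hj]
        have := hi₁ ⟨i, hi⟩
        simp only at this
        linarith [hy (j - n)]
      · rw [ha'' i hi, ha'' j hj, hb'' i hi, hb'' j hj]
        have h := hsep (i - n) (j - n) (by omega)
        simp only [hsub i hi] at h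
        exact h.imp (fun h => by linarith [hwl i]) fun h => by linarith
  · have hlow : a j₀ ≤ a' j := by
      by_cases hj : j < n
      · rw [ha' j hj]; exact hj₀ _
      · rw [ha'' j hj]; linarith [hx (j - n)]
    have hup : a' i + w i ≤ a j₀ + p := by
      by_cases hi : i < n
      · rw [ha' i hi]
        have := hpa ⟨i, hi⟩
        simp only at this
        linarith
      · rw [ha'' i hi]
        have := hxW (i - n)
        simp only [hsub i hi] at this
        linarith [hwl i]
    linarith
  · have hlow : b j₁ ≤ b' j := by
      by_cases hj : j < n
      · rw [hb' j hj]; exact hj₁ _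
      · rw [hb'' j hj]; linarith [hy (j - n), hj₁ i₁, hl i₁]
    have hup : b' i + l i ≤ b i₁ + l i₁ + tailHeight w l n := by
      by_cases hi : i < n
      · rw [hb' i hi]
        have := hi₁ ⟨i, hi⟩
        simp only at this
        linarith
      · rw [hb'' i hi]
        have := hyH (i - n)
        rw [hsub i hi] at this
        rw [tailHeight]
        linarith
    linarith

theorem Tval_pos_and_T0inf_le (hn : 0 < n) (hw : ∀ i, 0 < w i)
    (hl : ∀ i, 0 < l i) (hanti : Antitone l) (hwl : ∀ i, w i ≤ l i)
    (hs : Summable fun i => l i ^ 2) (hln : 2 * l n ≤ w 0)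
    (hM : IsPositioning (fun i : Fin n => w i) (fun i : Fin n => l i) a b) :
    0 < Tval (fun i : Fin n => w i) (fun i : Fin n => l i) a b ∧
      T0inf w l ≤ Tval (fun i : Fin n => w i) (fun i : Fin n => l i) a b *
        (1 + tailHeight w l n / l 0) := by
  have hle : T0inf w l ≤ _ := csInf_le (bddBelow_boxAreas hw hl)
    (mul_add_tailHeight_mem_boxAreas hn hl hanti hwl hs hln hM)
  have hp := le_pval (fun i : Fin n => w i) a ⟨0, hn⟩ ⟨0, hn⟩
  have hq := le_qval (fun i : Fin n => l i) b ⟨0, hn⟩ ⟨0, hn⟩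
  have hw0 := hw 0
  have hl0 := hl 0
  have hH : 0 ≤ tailHeight w l n :=
    add_nonneg (hl n).le (mul_nonneg (by positivity) (tsum_nonneg fun _ => sq_nonneg _))
  rw [Tval]
  set p := pval (fun i : Fin n => w i) a
  set q := qval (fun i : Fin n => l i) b
  simp only at hp hq
  have hp0 : 0 < p := by linarith
  have hq0 : l 0 ≤ q := by linarith
  refine ⟨mul_pos hp0 (by linarith), hle.trans ?_⟩
  have h1 : tailHeight w l n ≤ q * (tailHeight w l n / l 0) := by
    rw [mul_div_assoc', le_div_iff₀ hl0, mul_comm]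
    exact mul_le_mul_of_nonneg_right hq0 hH
  rw [mul_assoc]
  exact mul_le_mul_of_nonneg_left (by linarith) hp0.le

theorem eta_le (hn : 0 < n) (hw : ∀ i, 0 < w i)
    (hl : ∀ i, 0 < l i) (hanti : Antitone l) (hwl : ∀ i, w i ≤ l i)
    (hs : Summable fun i => l i ^ 2) (hln : 2 * l n ≤ w 0)
    (hM : IsPositioning (fun i : Fin n => w i) (fun i : Fin n => l i) a b) :
    eta (fun i : Fin n => w i) (fun i : Fin n => l i) a b ≤
      Sval (fun i : Fin n => w i) (fun i : Fin n => l i) * (1 + tailHeight w l n / l 0) /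
        T0inf w l := by
  obtain ⟨hT, hle⟩ := Tval_pos_and_T0inf_le hn hw hl hanti hwl hs hln hM
  have hS : 0 ≤ Sval (fun i : Fin n => w i) (fun i : Fin n => l i) :=
    Finset.sum_nonneg fun i _ => (mul_pos (hw i) (hl i)).le
  rw [eta, div_le_div_iff₀ hT (T0inf_pos hw hl hanti hwl hs)]
  calc _ ≤ _ := mul_le_mul_of_nonneg_left hle hS
    _ = _ := by ring

theorem IsPositioning.restrict {a b : ℕ → ℝ} (h : IsPositioning w l a b) (n : ℕ) :
    IsPositioning (fun i : Fin n => w i) (fun i : Fin n => l i) (fun i => a i) (fun i => b i) :=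
  fun i j hij => h i j fun e => hij (Fin.ext e)

theorem eta0_prefix_mem_Icc (hn : 0 < n) (hw : ∀ i, 0 < w i)
    (hl : ∀ i, 0 < l i) (hanti : Antitone l) (hwl : ∀ i, w i ≤ l i)
    (hs : Summable fun i => l i ^ 2) (hln : 2 * l n ≤ w 0) :
    eta0 (fun i : Fin n => w i) (fun i : Fin n => l i) ∈
      Set.Icc (Sval (fun i : Fin n => w i) (fun i : Fin n => l i) / T0inf w l)
        (Sval (fun i : Fin n => w i) (fun i : Fin n => l i) * (1 + tailHeight w l n / l 0) /
          T0inf w l) := by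
  have : Nonempty (Fin n) := ⟨⟨0, hn⟩⟩
  have hT := T0inf_pos hw hl hanti hwl hs
  have hne := boxAreas_nonempty hl hanti hwl hs
  have hS : 0 < Sval (fun i : Fin n => w i) (fun i : Fin n => l i) :=
    Finset.sum_pos (fun i _ => mul_pos (hw i) (hl i)) Finset.univ_nonempty
  have hlow : ∀ t ∈ boxAreas w l, Sval (fun i : Fin n => w i) (fun i : Fin n => l i) / t ≤
      eta0 (fun i : Fin n => w i) (fun i : Fin n => l i) := by
    rintro _ ⟨a, b, P, Q, hM, hP, hQ, rfl⟩
    have hM' := hM.restrict n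
    refine le_trans ?_ (le_csSup ⟨Sval (fun i : Fin n => w i) (fun i : Fin n => l i) *
      (1 + tailHeight w l n / l 0) / T0inf w l, ?_⟩ ⟨_, _, hM', rfl⟩)
    · have hpos := (Tval_pos_and_T0inf_le hn hw hl hanti hwl hs hln hM').1
      refine div_le_div_of_nonneg_left hS.le hpos ?_
      have hq := le_qval (fun i : Fin n => l i) (fun i => b i) ⟨0, hn⟩ ⟨0, hn⟩
      have hP0 := hP 0 0
      simp only at hq
      exact mul_le_mul (pval_le fun i j => hP i j) (qval_le fun i j => hQ i j)
        (by linarith [hl 0]) (by linarith [hw 0])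
    · rintro _ ⟨a, b, hM, rfl⟩
      exact eta_le hn hw hl hanti hwl hs hln hM
  obtain ⟨t₀, ht₀⟩ := hne
  have hpos : ∀ t ∈ boxAreas w l, 0 < t := fun t ht =>
    (mul_pos (hw 0) (hl 0)).trans_le (le_of_mem_boxAreas hw hl ht)
  have heta : 0 < eta0 (fun i : Fin n => w i) (fun i : Fin n => l i) :=
    (div_pos hS (hpos t₀ ht₀)).trans_le (hlow t₀ ht₀)
  constructor
  · rw [div_le_comm₀ hT heta]
    refine le_csInf ⟨t₀, ht₀⟩ fun t ht => ?_
    rw [div_le_comm₀ heta (hpos t ht)]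
    exact hlow t ht
  · obtain ⟨a, b, P, Q, hM, -⟩ := ht₀
    refine csSup_le ⟨_, _, _, hM.restrict n, rfl⟩ ?_
    rintro _ ⟨a, b, hM, rfl⟩
    exact eta_le hn hw hl hanti hwl hs hln hM

end Infinite

/-- Theorem 2: under (C1) and (C2), the best packing efficiency of the
infinite family, `η₀(A) = S(A)/T₀(A)`, is well-defined (`T₀(A) > 0`) and
`η₀(Aⁿ) → η₀(A)` as `n → ∞`. -/
theorem eta0_prefix_tendsto_eta0inf (w l : ℕ → ℝ)
    (hw : ∀ i, 0 < w i) (hl : ∀ i, 0 < l i)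
    (hC1 : Summable fun i => l i ^ 2)
    (hC2 : ∀ i, w i ≤ l i) (hC2' : ∀ i, l (i + 1) ≤ l i) :
    0 < T0inf w l ∧
    Filter.Tendsto (fun n : ℕ => eta0 (fun i : Fin n => w i) (fun i : Fin n => l i))
      Filter.atTop (nhds ((∑' i, w i * l i) / T0inf w l)) := by
  have hanti : Antitone l := antitone_nat_of_succ_le hC2'
  refine ⟨T0inf_pos hw hl hanti hC2 hC1, ?_⟩
  have hsum : Summable fun i => w i * l i :=
    hC1.of_nonneg_of_le (fun i => (mul_pos (hw i) (hl i)).le) fun i => by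
      rw [sq]
      exact mul_le_mul_of_nonneg_right (hC2 i) (hl i).le
  have hS : Tendsto (fun n : ℕ => Sval (fun i : Fin n => w i) (fun i : Fin n => l i)) atTop
      (𝓝 (∑' i, w i * l i)) := by
    simpa only [Sval, Fin.sum_univ_eq_sum_range fun i => w i * l i] using
      hsum.hasSum.tendsto_sum_nat
  have hH : Tendsto (fun n => 1 + tailHeight w l n / l 0) atTop (𝓝 1) := by
    simpa using ((tendsto_tailHeight (w := w) hC1).div_const (l 0)).const_add 1
  have hU := (hS.mul hH).div_const (T0inf w l)
  rw [mul_one] at hU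
  have hev : ∀ᶠ n in atTop, eta0 (fun i : Fin n => w i) (fun i : Fin n => l i) ∈
      Set.Icc (Sval (fun i : Fin n => w i) (fun i : Fin n => l i) / T0inf w l)
        (Sval (fun i : Fin n => w i) (fun i : Fin n => l i) * (1 + tailHeight w l n / l 0) /
          T0inf w l) := by
    filter_upwards [eventually_gt_atTop 0,
      (tendsto_zero_of_summable_sq hC1).eventually_le_const (half_pos (hw 0))] with n hn hln
    exact eta0_prefix_mem_Icc hn hw hl hanti hC2 hC1 (by linarith)
  exact tendsto_of_tendsto_of_tendsto_of_le_of_le' (hS.div_const _) hU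
    (hev.mono fun _ h => h.1) (hev.mono fun _ h => h.2)
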